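/- Let C and D be two finite cuts in an occurrence net N such that C ⊆ past(D). Then there exists a finite sequence of transitions t₁, t₂, …, t_r such that firing them consecutively leads from C to D, i.e., C →t₁ · →t₂ · … →t_r D. -/

import Mathlib

/-- A Petri net over places `P` and transitions `T`: each transition has a
nonempty finite multiset precondition and postcondition (encoding the flow
relation `F`), and there is a finite initial marking. -/
structure PetriNet (P T : Type) where
  pre  : T → Multiset P
  post : T → Multiset P
  init : Multiset P
  pre_ne  : ∀ t, pre t ≠ 0
  post_ne : ∀ t, post t ≠ 0

namespace PetriNet

variable {P T : Type}

/-- A transition `t` is enabled in a marking `M` if `pre t ⊆ M`. -/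
def Enabled (N : PetriNet P T) (M : Multiset P) (t : T) : Prop :=
  N.pre t ≤ M

/-- `M →t M'`: firing an enabled transition. -/
def Fires [DecidableEq P] (N : PetriNet P T) (M : Multiset P) (t : T) (M' : Multiset P) : Prop :=
  N.pre t ≤ M ∧ M' = M - N.pre t + N.post t

def Step [DecidableEq P] (N : PetriNet P T) (M M' : Multiset P) : Prop :=
  ∃ t, N.Fires M t M'

/-- A marking is reachable if obtained from the initial marking by firing a
finite sequence of transitions. -/
def Reachable [DecidableEq P] (N : PetriNet P T) (M : Multiset P) : Prop :=
  Relation.ReflTransGen N.Step N.init M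

/-- The flow relation on nodes (places ⊕ transitions). -/
def Flow (N : PetriNet P T) : P ⊕ T → P ⊕ T → Prop
  | Sum.inl p, Sum.inr t => p ∈ N.pre t
  | Sum.inr t, Sum.inl p => p ∈ N.post t
  | _, _ => False

/-- `<` : transitive closure of the flow relation. -/
def CLt (N : PetriNet P T) : P ⊕ T → P ⊕ T → Prop := Relation.TransGen N.Flow

/-- `≤` : reflexive-transitive closure of the flow relation. -/
def CLe (N : PetriNet P T) : P ⊕ T → P ⊕ T → Prop := Relation.ReflTransGen N.Flow

/-- Nodes `x`, `y` are in conflict if from some place `q` (distinct from both)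
one can reach `x` and `y` via two different outgoing transitions of `q`. -/
def Conflict (N : PetriNet P T) (x y : P ⊕ T) : Prop :=
  ∃ q : P, Sum.inl q ≠ x ∧ Sum.inl q ≠ y ∧
    ∃ t₁ t₂ : T, t₁ ≠ t₂ ∧ q ∈ N.pre t₁ ∧ q ∈ N.pre t₂ ∧
      N.CLe (Sum.inr t₁) x ∧ N.CLe (Sum.inr t₂) y

/-- Concurrent: neither causally related nor in conflict. -/
def Concurrent (N : PetriNet P T) (x y : P ⊕ T) : Prop :=
  ¬ N.CLe x y ∧ ¬ N.CLe y x ∧ ¬ N.Conflict x y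

/-- Occurrence net: pre/postconditions are sets, every place has at most one
incoming transition, the initial marking is the set of places without incoming
transitions, the inverse flow relation is well-founded, and no transition is in
self-conflict. -/
structure IsOccurrence (N : PetriNet P T) : Prop where
  pre_nodup : ∀ t, (N.pre t).Nodup
  post_nodup : ∀ t, (N.post t).Nodup
  unique_pre : ∀ p : P, ∀ t₁ t₂ : T, p ∈ N.post t₁ → p ∈ N.post t₂ → t₁ = t₂
  init_nodup : N.init.Nodup
  mem_init : ∀ p : P, p ∈ N.init ↔ ∀ t : T, p ∉ N.post t
  wf : WellFounded N.Flow
  no_self_conflict : ∀ t : T, ¬ N.Conflict (Sum.inr t) (Sum.inr t)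

def PairwiseConcurrent (N : PetriNet P T) (C : Set P) : Prop :=
  ∀ p ∈ C, ∀ q ∈ C, p ≠ q → N.Concurrent (Sum.inl p) (Sum.inl q)

/-- A cut: a maximal set of pairwise concurrent places. -/
def IsCut (N : PetriNet P T) (C : Set P) : Prop :=
  N.PairwiseConcurrent C ∧ ∀ D : Set P, N.PairwiseConcurrent D → C ⊆ D → D = C

end PetriNet

/-- `(N₁, fP, fT)` is an initial branching process of `N₂`: `N₁` is an
occurrence net, `(fP, fT)` is an initial homomorphism, and transitions with the
same precondition and the same image coincide. -/
structure IsBranchingProcess {P₁ T₁ P₂ T₂ : Type}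
    (N₁ : PetriNet P₁ T₁) (N₂ : PetriNet P₂ T₂)
    (fP : P₁ → P₂) (fT : T₁ → T₂) : Prop where
  occ : N₁.IsOccurrence
  map_pre : ∀ t, (N₁.pre t).map fP = N₂.pre (fT t)
  map_post : ∀ t, (N₁.post t).map fP = N₂.post (fT t)
  map_init : N₁.init.map fP = N₂.init
  trans_inj : ∀ t₁ t₂, N₁.pre t₁ = N₁.pre t₂ → fT t₁ = fT t₂ → t₁ = t₂


namespace PetriNet

variable {P T : Type} {N : PetriNet P T}

theorem CLe.exists_pre_of_ne {p : P} {x : P ⊕ T} (h : N.CLe (Sum.inl p) x) (hne : Sum.inl p ≠ x) :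
    ∃ t, p ∈ N.pre t ∧ N.CLe (Sum.inr t) x := by
  rcases Relation.ReflTransGen.cases_head h with h | ⟨y, hy, hyx⟩
  · exact absurd h hne
  · rcases y with q | t
    · exact hy.elim
    · exact ⟨t, hy, hyx⟩

theorem CLe.exists_post_head {t : T} {p : P} (h : N.CLe (Sum.inr t) (Sum.inl p)) :
    ∃ r ∈ N.post t, N.CLe (Sum.inl r) (Sum.inl p) := by
  rcases Relation.ReflTransGen.cases_head h with h | ⟨y, hy, hyx⟩
  · cases h
  · rcases y with q | t
    · exact ⟨q, hy, hyx⟩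
    · exact hy.elim

theorem CLe.exists_post_of_ne {x : P ⊕ T} {p : P} (h : N.CLe x (Sum.inl p)) (hne : x ≠ Sum.inl p) :
    ∃ t, p ∈ N.post t ∧ N.CLe x (Sum.inr t) := by
  rcases Relation.ReflTransGen.cases_tail h with h | ⟨y, hxy, hy⟩
  · exact absurd h.symm hne
  · rcases y with q | t
    · exact hy.elim
    · exact ⟨t, hy, hxy⟩

theorem CLe.exists_pre_tail {p : P} {t : T} (h : N.CLe (Sum.inl p) (Sum.inr t)) :
    ∃ q ∈ N.pre t, N.CLe (Sum.inl p) (Sum.inl q) := by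
  rcases Relation.ReflTransGen.cases_tail h with h | ⟨y, hxy, hy⟩
  · cases h
  · rcases y with q | t
    · exact ⟨q, hy, hxy⟩
    · exact hy.elim

theorem cLe_of_mem_pre {p : P} {t : T} (h : p ∈ N.pre t) : N.CLe (Sum.inl p) (Sum.inr t) :=
  Relation.ReflTransGen.single (r := N.Flow) (a := Sum.inl p) (b := Sum.inr t) h

theorem cLe_of_mem_post {p : P} {t : T} (h : p ∈ N.post t) : N.CLe (Sum.inr t) (Sum.inl p) :=
  Relation.ReflTransGen.single (r := N.Flow) (a := Sum.inr t) (b := Sum.inl p) h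

theorem CLe.trans {x y z : P ⊕ T} (h : N.CLe x y) (h' : N.CLe y z) : N.CLe x z :=
  Relation.ReflTransGen.trans h h'

theorem CLe.refl (x : P ⊕ T) : N.CLe x x := Relation.ReflTransGen.refl

theorem Conflict.symm {x y : P ⊕ T} (h : N.Conflict x y) : N.Conflict y x := by
  obtain ⟨q, hx, hy, t, u, htu, ht, hu, htx, huy⟩ := h
  exact ⟨q, hy, hx, u, t, htu.symm, hu, ht, huy, htx⟩

theorem Concurrent.symm {x y : P ⊕ T} (h : N.Concurrent x y) : N.Concurrent y x :=
  ⟨h.2.1, h.1, fun hc => h.2.2 hc.symm⟩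

theorem PairwiseConcurrent.eq_of_cLe {C : Set P} (hC : N.PairwiseConcurrent C) {p q : P}
    (hp : p ∈ C) (hq : q ∈ C) (h : N.CLe (Sum.inl p) (Sum.inl q)) : p = q := by
  by_contra hne
  exact (hC p hp q hq hne).1 h

/-- A place that is concurrent to all other elements of a cut belongs to the cut. -/
theorem IsCut.mem_of_concurrent {C : Set P} (hC : N.IsCut C) {p : P}
    (h : ∀ c ∈ C, N.Concurrent (Sum.inl p) (Sum.inl c)) : p ∈ C := by
  have hins : N.PairwiseConcurrent (insert p C) := by
    rintro a (rfl | ha) b (rfl | hb) hab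
    · exact absurd rfl hab
    · exact h b hb
    · exact (h a ha).symm
    · exact hC.1 a ha b hb hab
  rw [← hC.2 _ hins (Set.subset_insert p C)]
  exact Set.mem_insert p C

namespace IsOccurrence

theorem not_cLe_of_mem_pre (hN : N.IsOccurrence) {p : P} {t : T} (h : p ∈ N.pre t) :
    ¬ N.CLe (Sum.inr t) (Sum.inl p) := fun hle =>
  hN.wf.transGen.irrefl.irrefl (Sum.inl p)
    (Relation.TransGen.head' (r := N.Flow) (a := Sum.inl p) (b := Sum.inr t) h hle)

theorem not_cLe_of_mem_post (hN : N.IsOccurrence) {p : P} {t : T} (h : p ∈ N.post t) :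
    ¬ N.CLe (Sum.inl p) (Sum.inr t) := fun hle =>
  hN.wf.transGen.irrefl.irrefl (Sum.inr t)
    (Relation.TransGen.head' (r := N.Flow) (a := Sum.inr t) (b := Sum.inl p) h hle)

theorem cLe_of_mem_post_of_ne (hN : N.IsOccurrence) {x : P ⊕ T} {p : P} {t : T}
    (hp : p ∈ N.post t) (h : N.CLe x (Sum.inl p)) (hne : x ≠ Sum.inl p) :
    N.CLe x (Sum.inr t) := by
  obtain ⟨s, hs, hxs⟩ := h.exists_post_of_ne hne
  rwa [hN.unique_pre p t s hp hs]

theorem finite_past (hN : N.IsOccurrence) (x : P ⊕ T) : {y | N.CLe y x}.Finite := by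
  induction x using hN.wf.induction with
  | _ x ih =>
    have hpred : {y | N.Flow y x}.Finite := by
      classical
      rcases x with p | t
      · refine Set.Subsingleton.finite ?_
        rintro (a | a) ha (b | b) hb
        · exact ha.elim
        · exact ha.elim
        · exact hb.elim
        · rw [hN.unique_pre p a b ha hb]
      · refine ((N.pre t).toFinset.finite_toSet.image Sum.inl).subset ?_
        rintro (a | a) ha
        · exact ⟨a, Multiset.mem_toFinset.2 ha, rfl⟩
        · exact ha.elim
    refine ((hpred.biUnion ih).insert x).subset ?_
    intro y hy
    rcases Relation.ReflTransGen.cases_tail hy with h | ⟨z, hyz, hz⟩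
    · exact Or.inl h.symm
    · exact Or.inr (Set.mem_biUnion hz hyz)

/-- The past of a set of pairwise concurrent places is conflict-free. -/
theorem eq_of_cLe (hN : N.IsOccurrence) {D : Set P} (hD : N.PairwiseConcurrent D)
    {q : P} {t u : T} (ht : q ∈ N.pre t) (hu : q ∈ N.pre u) {d e : P} (hd : d ∈ D) (he : e ∈ D)
    (htd : N.CLe (Sum.inr t) (Sum.inl d)) (hue : N.CLe (Sum.inr u) (Sum.inl e)) : t = u := by
  by_contra htu
  by_cases hde : d = e
  · subst hde
    obtain ⟨s, hs, hts⟩ := htd.exists_post_of_ne (by simp)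
    exact hN.no_self_conflict s ⟨q, by simp, by simp, t, u, htu, ht, hu, hts,
      hN.cLe_of_mem_post_of_ne hs hue (by simp)⟩
  · refine (hD d hd e he hde).2.2 ⟨q, ?_, ?_, t, u, htu, ht, hu, htd, hue⟩
    · intro h
      exact hN.not_cLe_of_mem_pre ht (h ▸ htd)
    · intro h
      exact hN.not_cLe_of_mem_pre hu (h ▸ hue)

theorem not_conflict (hN : N.IsOccurrence) {D : Set P} (hD : N.PairwiseConcurrent D)
    {x y : P ⊕ T} {d e : P} (hd : d ∈ D) (he : e ∈ D)
    (hxd : N.CLe x (Sum.inl d)) (hye : N.CLe y (Sum.inl e)) : ¬ N.Conflict x y := by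
  rintro ⟨q, -, -, t, u, htu, ht, hu, htx, huy⟩
  exact htu (hN.eq_of_cLe hD ht hu hd he (htx.trans hxd) (huy.trans hye))

/-- The past of a cut is closed under postconditions. -/
theorem post_subset_past (hN : N.IsOccurrence) {D : Set P} (hD : N.IsCut D) {t : T} {d : P}
    (hd : d ∈ D) (htd : N.CLe (Sum.inr t) (Sum.inl d)) {r : P} (hr : r ∈ N.post t) :
    ∃ e ∈ D, N.CLe (Sum.inl r) (Sum.inl e) := by
  by_contra! hcon
  have hrD : r ∉ D := fun h => hcon r h (CLe.refl _)
  refine hrD (hD.mem_of_concurrent fun e he => ⟨hcon e he, fun her => ?_, ?_⟩)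
  · have het := hN.cLe_of_mem_post_of_ne hr her (by rintro ⟨⟩; exact hrD he)
    obtain rfl := hD.1.eq_of_cLe he hd (het.trans htd)
    obtain ⟨q, hq, heq⟩ := het.exists_pre_tail
    exact hN.not_cLe_of_mem_pre hq (htd.trans heq)
  · rintro ⟨q, -, -, u, v, huv, hu, hv, hur, hve⟩
    exact huv (hN.eq_of_cLe hD.1 hu hv hd he
      ((hN.cLe_of_mem_post_of_ne hr hur (by simp)).trans htd) hve)

/-- A transition in the past of `D` but not in that of the cut `C` is enabled at `C` if all
smaller transitions are in the past of `C`. -/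
theorem mem_of_mem_pre (hN : N.IsOccurrence) {C D : Set P} (hC : N.IsCut C)
    (hD : N.PairwiseConcurrent D)
    (hsub : ∀ p ∈ C, ∃ d ∈ D, N.CLe (Sum.inl p) (Sum.inl d)) {t : T} {d : P} (hd : d ∈ D)
    (htd : N.CLe (Sum.inr t) (Sum.inl d)) (htC : ∀ c ∈ C, ¬ N.CLe (Sum.inr t) (Sum.inl c))
    {p : P} (hp : p ∈ N.pre t)
    (hmin : ∀ u, N.CLe (Sum.inr u) (Sum.inl p) → ∃ c ∈ C, N.CLe (Sum.inr u) (Sum.inl c)) :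
    p ∈ C := by
  by_contra hpC
  refine hpC (hC.mem_of_concurrent fun c hc => ⟨fun hpc => ?_, fun hcp => ?_, ?_⟩)
  · obtain ⟨u, hu, huc⟩ := hpc.exists_pre_of_ne (by rintro ⟨⟩; exact hpC hc)
    obtain ⟨e, he, hce⟩ := hsub c hc
    obtain rfl := hN.eq_of_cLe hD hp hu hd he htd (huc.trans hce)
    exact htC c hc huc
  · obtain ⟨u, hu, hup⟩ := hcp.exists_pre_of_ne (by rintro ⟨⟩; exact hpC hc)
    obtain ⟨c', hc', huc'⟩ := hmin u hup
    obtain rfl := hC.1.eq_of_cLe hc hc' ((cLe_of_mem_pre hu).trans huc')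
    exact hN.not_cLe_of_mem_pre hu huc'
  · obtain ⟨e, he, hce⟩ := hsub c hc
    exact hN.not_conflict hD hd he ((cLe_of_mem_pre hp).trans htd) hce

/-- Firing a transition at a cut inside the past of a cut `D` yields a cut again. -/
theorem isCut_fire (hN : N.IsOccurrence) {C C' D : Set P} (hC : N.IsCut C)
    (hD : N.PairwiseConcurrent D) {t : T} (hpre : ∀ p ∈ N.pre t, p ∈ C)
    (htC : ∀ c ∈ C, ¬ N.CLe (Sum.inr t) (Sum.inl c))
    (hC' : ∀ p, p ∈ C' ↔ (p ∈ C ∧ p ∉ N.pre t) ∨ p ∈ N.post t)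
    (hsub : ∀ p ∈ C', ∃ d ∈ D, N.CLe (Sum.inl p) (Sum.inl d)) : N.IsCut C' := by
  have hold : ∀ c ∈ C, c ∉ N.pre t → ∀ r ∈ N.post t, N.Concurrent (Sum.inl c) (Sum.inl r) := by
    intro c hc hct r hr
    refine ⟨fun hcr => ?_, fun hrc => htC c hc ((cLe_of_mem_post hr).trans hrc), ?_⟩
    · have := hN.cLe_of_mem_post_of_ne hr hcr
        (by rintro ⟨⟩; exact htC _ hc (cLe_of_mem_post hr))
      obtain ⟨q, hq, hcq⟩ := this.exists_pre_tail
      obtain rfl := hC.1.eq_of_cLe hc (hpre q hq) hcq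
      exact hct hq
    · obtain ⟨d, hd, hcd⟩ := hsub c ((hC' c).2 (Or.inl ⟨hc, hct⟩))
      obtain ⟨e, he, hre⟩ := hsub r ((hC' r).2 (Or.inr hr))
      exact hN.not_conflict hD hd he hcd hre
  have hnew : ∀ r ∈ N.post t, ∀ s ∈ N.post t, r ≠ s → ¬ N.CLe (Sum.inl r) (Sum.inl s) := by
    intro r hr s hs hrs h
    exact hN.not_cLe_of_mem_post hr
      (hN.cLe_of_mem_post_of_ne hs h (fun h => hrs (Sum.inl.inj h)))
  obtain ⟨r, hr⟩ := Multiset.exists_mem_of_ne_zero (N.post_ne t)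
  refine ⟨?_, fun E hE hsubE => (Set.Subset.antisymm hsubE ?_).symm⟩
  · intro p hp q hq hpq
    rcases (hC' p).1 hp with ⟨hpC, hpt⟩ | hpt <;> rcases (hC' q).1 hq with ⟨hqC, hqt⟩ | hqt
    · exact hC.1 p hpC q hqC hpq
    · exact hold p hpC hpt q hqt
    · exact (hold q hqC hqt p hpt).symm
    · obtain ⟨d, hd, hpd⟩ := hsub p hp
      obtain ⟨e, he, hqe⟩ := hsub q hq
      exact ⟨hnew p hpt q hqt hpq, hnew q hqt p hpt hpq.symm,
        hN.not_conflict hD hd he hpd hqe⟩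
  · intro e he
    by_contra heC'
    have hpost : ∀ s ∈ N.post t, s ∈ E := fun s hs => hsubE ((hC' s).2 (Or.inr hs))
    have hne : e ≠ r := by
      rintro rfl
      exact heC' ((hC' e).2 (Or.inr hr))
    have hpc : ∀ {c}, c ∈ N.pre t → N.CLe (Sum.inl c) (Sum.inl r) := fun hc =>
      (cLe_of_mem_pre hc).trans (cLe_of_mem_post hr)
    have het : e ∉ N.pre t := fun h => hne (hE.eq_of_cLe he (hpost r hr) (hpc h))
    have heC : e ∉ C := fun h => heC' ((hC' e).2 (Or.inl ⟨h, het⟩))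
    refine heC (hC.mem_of_concurrent fun c hc => ?_)
    have hec : e ≠ c := by
      rintro rfl
      exact heC hc
    by_cases hct : c ∈ N.pre t
    · refine ⟨fun h => hne (hE.eq_of_cLe he (hpost r hr) (h.trans (hpc hct))), fun h => ?_, ?_⟩
      · obtain ⟨u, hu, hue⟩ := h.exists_pre_of_ne (fun h => hec (Sum.inl.inj h).symm)
        obtain rfl := hN.eq_of_cLe hE hu hct he (hpost r hr) hue (cLe_of_mem_post hr)
        obtain ⟨s, hs, hse⟩ := hue.exists_post_head
        obtain rfl := hE.eq_of_cLe (hpost s hs) he hse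
        exact heC' ((hC' s).2 (Or.inr hs))
      · exact hN.not_conflict hE he (hpost r hr) (CLe.refl _) (hpc hct)
    · exact hE e he c (hsubE ((hC' c).2 (Or.inl ⟨hc, hct⟩))) hec

theorem reflTransGen_step [DecidableEq P] (hN : N.IsOccurrence) {D : Finset P}
    (hD : N.IsCut (D : Set P)) (C : Finset P) (hC : N.IsCut (C : Set P))
    (hsub : ∀ p ∈ C, ∃ d ∈ D, N.CLe (Sum.inl p) (Sum.inl d)) :
    Relation.ReflTransGen N.Step C.val D.val := by
  let between (C : Finset P) : Set T :=
    {t | (∃ d ∈ D, N.CLe (Sum.inr t) (Sum.inl d)) ∧ ∀ c ∈ C, ¬ N.CLe (Sum.inr t) (Sum.inl c)}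
  have hfin (C : Finset P) : (between C).Finite := by
    refine ((D.finite_toSet.biUnion fun d _ => hN.finite_past (Sum.inl d)).preimage
      Sum.inr_injective.injOn).subset ?_
    rintro t ⟨⟨d, hd, htd⟩, -⟩
    exact Set.mem_biUnion hd htd
  induction hn : (between C).ncard using Nat.strong_induction_on generalizing C with
  | _ n ih =>
    subst hn
    rcases (between C).eq_empty_or_nonempty with hempty | hne
    · have hCD : C ⊆ D := by
        intro c hc
        obtain ⟨d, hd, hcd⟩ := hsub c hc
        by_contra hcD
        obtain ⟨t, ht, htd⟩ := hcd.exists_pre_of_ne (by rintro ⟨⟩; exact hcD hd)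
        refine Set.eq_empty_iff_forall_notMem.1 hempty t ⟨⟨d, hd, htd⟩, fun c' hc' htc' => ?_⟩
        obtain rfl := hC.1.eq_of_cLe hc hc' ((cLe_of_mem_pre ht).trans htc')
        exact hN.not_cLe_of_mem_pre ht htc'
      rw [Finset.coe_injective (hC.2 D hD.1 (by exact_mod_cast hCD))]
    · obtain ⟨t, ht, hmin⟩ :=
        (InvImage.wf (Sum.inr : T → P ⊕ T) hN.wf.transGen).has_min (between C) hne
      obtain ⟨⟨d, hd, htd⟩, htC⟩ := id ht
      have hpre : ∀ p ∈ N.pre t, p ∈ C := by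
        intro p hp
        refine hN.mem_of_mem_pre hC hD.1 hsub hd htd htC hp fun u hup => ?_
        by_contra! hu
        exact hmin u ⟨⟨d, hd, (hup.trans (cLe_of_mem_pre hp)).trans htd⟩, hu⟩
          (Relation.TransGen.tail' (r := N.Flow) (b := Sum.inl p) (c := Sum.inr t) hup hp)
      have hdisj : ∀ r ∈ N.post t, r ∉ C := fun r hr hrC => htC r hrC (cLe_of_mem_post hr)
      have hnodup : (C.val - N.pre t + N.post t).Nodup := by
        refine Multiset.nodup_add.2 ⟨Multiset.nodup_of_le (Multiset.sub_le_self _ _) C.nodup,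
          hN.post_nodup t, Multiset.disjoint_left.2 fun {r} hr hrt => hdisj r hrt ?_⟩
        exact Multiset.mem_of_le (Multiset.sub_le_self _ _) hr
      let C' : Finset P := ⟨C.val - N.pre t + N.post t, hnodup⟩
      have hmem : ∀ p, p ∈ C' ↔ (p ∈ C ∧ p ∉ N.pre t) ∨ p ∈ N.post t := by
        intro p
        change p ∈ C.val - N.pre t + N.post t ↔ _
        rw [Multiset.mem_add, Multiset.mem_sub_of_nodup C.nodup, Finset.mem_val]
      have hsub' : ∀ p ∈ C', ∃ d ∈ D, N.CLe (Sum.inl p) (Sum.inl d) := by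
        intro p hp
        rcases (hmem p).1 hp with h | h
        · exact hsub p h.1
        · exact hN.post_subset_past hD hd htd h
      have hlt : between C' ⊂ between C := by
        obtain ⟨r, hr⟩ := Multiset.exists_mem_of_ne_zero (N.post_ne t)
        have hrC' : r ∈ C' := (hmem r).2 (Or.inr hr)
        refine ⟨fun u ⟨hud, hu⟩ => ⟨hud, fun c hc huc => ?_⟩, fun h =>
          (h ht).2 r hrC' (cLe_of_mem_post hr)⟩
        by_cases hct : c ∈ N.pre t
        · exact hu r hrC' ((huc.trans (cLe_of_mem_pre hct)).trans (cLe_of_mem_post hr))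
        · exact hu c ((hmem c).2 (Or.inl ⟨hc, hct⟩)) huc
      have hle : N.pre t ≤ C.val := (Multiset.le_iff_subset (hN.pre_nodup t)).2 hpre
      exact Relation.ReflTransGen.head ⟨t, hle, rfl⟩
        (ih _ (Set.ncard_lt_ncard hlt (hfin C)) C'
          (hN.isCut_fire hC hD.1 hpre htC hmem hsub') hsub' rfl)

end IsOccurrence

end PetriNet

/-- If `C` and `D` are finite cuts of an occurrence net with `C ⊆ past(D)`,
then `D` can be reached from `C` by firing a finite sequence of transitions. -/
theorem cut_reaches_cut {P T : Type} [DecidableEq P] (N : PetriNet P T)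
    (hN : N.IsOccurrence) (C D : Set P) (hC : N.IsCut C) (hD : N.IsCut D)
    (hCf : C.Finite) (hDf : D.Finite)
    (hsub : ∀ p ∈ C, ∃ d ∈ D, N.CLe (Sum.inl p) (Sum.inl d)) :
    Relation.ReflTransGen N.Step hCf.toFinset.val hDf.toFinset.val := by
  refine hN.reflTransGen_step (by rwa [hDf.coe_toFinset]) _ (by rwa [hCf.coe_toFinset]) ?_
  simpa using hsub
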